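/- Let A be a complex unital Banach algebra, let H, D ∈ A, δ > 0, and r a positive natural number, and suppose: (i) ‖exp(u•H)‖ ≤ 1, ‖exp(u•D)‖ ≤ 1 and ‖exp(u•(H + D))‖ ≤ 1 for every u ∈ [0, r·δ]; (ii) (‖H‖/2 + ‖D‖)·δ ≤ 1; and (iii) K, N ∈ A satisfy ‖K‖ ≤ 1 and ‖N‖ ≤ 1. Set ε_H = ‖exp((δ/2)•H) − K‖ and ε_D = ‖exp(δ•D) − N‖. Then ‖exp((r·δ)•(H + D)) − (K * N * K)^r‖ ≤ (‖H*D − D*H‖/3)·(‖H‖/2 + ‖D‖)·r·δ³ + 2·r·(ε_H + ε_D). -/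

import Mathlib

open NormedSpace

section StrangSplitting

variable {A : Type*} [NormedRing A]

theorem norm_mul_le_of_norm_le_one_left {a b : A} {c : ℝ} (ha : ‖a‖ ≤ 1) (hb : ‖b‖ ≤ c) :
    ‖a * b‖ ≤ c :=
  (norm_mul_le a b).trans
    ((mul_le_of_le_one_left (norm_nonneg b) ha).trans hb)

theorem norm_mul_le_of_norm_le_one_right {a b : A} {c : ℝ} (ha : ‖a‖ ≤ c) (hb : ‖b‖ ≤ 1) :
    ‖a * b‖ ≤ c :=
  (norm_mul_le a b).trans
    ((mul_le_of_le_one_right (norm_nonneg a) hb).trans ha)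

theorem norm_pow_le_one_of_norm_le_one (h1 : ‖(1 : A)‖ ≤ 1) {a : A} (ha : ‖a‖ ≤ 1) (n : ℕ) :
    ‖a ^ n‖ ≤ 1 := by
  induction n with
  | zero => simpa using h1
  | succ n ih =>
    rw [pow_succ]
    exact norm_mul_le_of_norm_le_one_left ih ha

theorem norm_pow_sub_pow_le_of_norm_le_one (h1 : ‖(1 : A)‖ ≤ 1) {a b : A} (ha : ‖a‖ ≤ 1)
    (hb : ‖b‖ ≤ 1) (n : ℕ) : ‖a ^ n - b ^ n‖ ≤ n * ‖a - b‖ := by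
  induction n with
  | zero => simp
  | succ n ih =>
    have key : a ^ (n + 1) - b ^ (n + 1) = a ^ n * (a - b) + (a ^ n - b ^ n) * b := by
      rw [pow_succ, pow_succ]; noncomm_ring
    rw [key]
    refine (norm_add_le_of_le (norm_mul_le_of_norm_le_one_left
      (norm_pow_le_one_of_norm_le_one h1 ha n) le_rfl)
      (norm_mul_le_of_norm_le_one_right ih hb)).trans_eq ?_
    push_cast; ring

theorem norm_commutator_le (a b : A) : ‖a * b - b * a‖ ≤ 2 * ‖a‖ * ‖b‖ := by
  refine (norm_sub_le_of_le (norm_mul_le a b) (norm_mul_le b a)).trans_eq ?_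
  ring

theorem norm_mul_mul_sub_mul_mul_le {P K Q N : A} (hP : ‖P‖ ≤ 1) (hK : ‖K‖ ≤ 1) (hQ : ‖Q‖ ≤ 1)
    (hN : ‖N‖ ≤ 1) : ‖P * Q * P - K * N * K‖ ≤ 2 * ‖P - K‖ + ‖Q - N‖ := by
  have key : P * Q * P - K * N * K = P * (Q * (P - K)) + P * ((Q - N) * K) + (P - K) * (N * K) := by
    noncomm_ring
  rw [key]
  refine (norm_add_le_of_le (norm_add_le_of_le
    (norm_mul_le_of_norm_le_one_left hP (norm_mul_le_of_norm_le_one_left hQ le_rfl))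
    (norm_mul_le_of_norm_le_one_left hP (norm_mul_le_of_norm_le_one_right le_rfl hK)))
    (norm_mul_le_of_norm_le_one_right le_rfl
      (norm_mul_le_of_norm_le_one_left hN hK))).trans_eq ?_
  ring

/-- A function on `[0, t]` whose derivative is bounded in norm by the derivative of `B`, where
`B 0 = 0`, moves by at most `B t`. -/
theorem norm_sub_le_of_norm_deriv_le {E : Type*} [NormedAddCommGroup E] [NormedSpace ℝ E]
    {f f' : ℝ → E} {B B' : ℝ → ℝ} {t : ℝ} (ht : 0 ≤ t) (hf : ∀ s, HasDerivAt f (f' s) s)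
    (hB : ∀ s, HasDerivAt B (B' s) s) (hB0 : B 0 = 0)
    (bound : ∀ s ∈ Set.Icc 0 t, ‖f' s‖ ≤ B' s) : ‖f t - f 0‖ ≤ B t := by
  have hg : ∀ s, HasDerivAt (fun s => f s - f 0) (f' s) s := fun s => (hf s).sub_const _
  exact image_norm_le_of_norm_deriv_right_le_deriv_boundary (a := 0) (b := t)
    (fun s _ => (hg s).continuousAt.continuousWithinAt) (fun s _ => (hg s).hasDerivWithinAt)
    (by simp [hB0]) hB (fun s hs => bound s (Set.Ico_subset_Icc_self hs)) (Set.right_mem_Icc.2 ht)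

variable [NormedAlgebra ℝ A] [CompleteSpace A]

theorem exp_smul_eq_mul_exp_sub_smul (X : A) (t s : ℝ) :
    exp (t • X) = exp (s • X) * exp ((t - s) • X) := by
  let := NormedAlgebra.restrictScalars ℚ ℝ A
  rw [← exp_add_of_commute (((Commute.refl X).smul_left s).smul_right (t - s)), ← add_smul,
    add_sub_cancel]

theorem hasDerivAt_exp_sub_smul_const (X : A) (t s : ℝ) :
    HasDerivAt (fun s : ℝ => exp ((t - s) • X)) (-(X * exp ((t - s) • X))) s := by
  have h := (hasDerivAt_exp_smul_const' X (t - s)).scomp s ((hasDerivAt_id s).const_sub t)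
  simpa [Function.comp_def] using h

theorem hasDerivAt_exp_mul_mul_exp (X Y : A) (t s : ℝ) :
    HasDerivAt (fun s : ℝ => exp (s • X) * Y * exp ((t - s) • X))
      (exp (s • X) * (X * Y - Y * X) * exp ((t - s) • X)) s := by
  refine (((hasDerivAt_exp_smul_const X s).mul_const Y).mul
    (hasDerivAt_exp_sub_smul_const X t s)).congr_deriv ?_
  noncomm_ring

theorem norm_exp_commutator_le {X : A} (Y : A) {t : ℝ} (ht : 0 ≤ t)
    (hX : ∀ u ∈ Set.Icc 0 t, ‖exp (u • X)‖ ≤ 1) :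
    ‖exp (t • X) * Y - Y * exp (t • X)‖ ≤ t * ‖X * Y - Y * X‖ := by
  have h := norm_sub_le_of_norm_deriv_le ht (hasDerivAt_exp_mul_mul_exp X Y t)
    (fun s => (hasDerivAt_id s).mul_const ‖X * Y - Y * X‖) (by simp) (fun s hs => by
      rw [one_mul]
      exact norm_mul_le_of_norm_le_one_right
        (norm_mul_le_of_norm_le_one_left (hX s hs) le_rfl)
        (hX _ ⟨by linarith [hs.2], by linarith [hs.1]⟩))
  simpa using h

/-- The defect of the Strang splitting `exp (t • X) * exp (t • Y) * exp (t • X)` as a solution of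
`S' = (2 • X + Y) * S`. -/
theorem norm_strang_defect_le {X Y : A} {t : ℝ} (ht : 0 ≤ t)
    (hX : ∀ u ∈ Set.Icc 0 t, ‖exp (u • X)‖ ≤ 1) (hY : ∀ u ∈ Set.Icc 0 t, ‖exp (u • Y)‖ ≤ 1) :
    ‖(exp (t • X) * Y - Y * exp (t • X)) * exp (t • Y) * exp (t • X)
        + exp (t • X) * (exp (t • Y) * X - X * exp (t • Y)) * exp (t • X)‖
      ≤ t ^ 2 * (‖X * Y - Y * X‖ * (‖X‖ + ‖Y‖)) := by
  set C := X * Y - Y * X with hC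
  have htt : t ∈ Set.Icc 0 t := ⟨ht, le_rfl⟩
  have hG : ∀ s, HasDerivAt (fun s : ℝ =>
      exp (s • X) * Y * exp ((t - s) • X) * (exp (t • Y) * exp (t • X))
        + exp (t • X) * (exp (s • Y) * X * exp ((t - s) • Y)) * exp (t • X))
      (exp (s • X) * C * exp ((t - s) • X) * (exp (t • Y) * exp (t • X))
        + exp (t • X) * (exp (s • Y) * (Y * X - X * Y) * exp ((t - s) • Y)) * exp (t • X)) s :=
    fun s => ((hasDerivAt_exp_mul_mul_exp X Y t s).mul_const _).add
      (((hasDerivAt_exp_mul_mul_exp Y X t s).const_mul _).mul_const _)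
  have hB : ∀ s : ℝ, HasDerivAt
      (fun s : ℝ => (2 * t * s - s ^ 2) * (‖X‖ * ‖C‖) + s ^ 2 * (‖Y‖ * ‖C‖))
      ((t - s) * (2 * ‖X‖ * ‖C‖) + s * (2 * ‖Y‖ * ‖C‖)) s := by
    intro s
    refine (((((hasDerivAt_id s).const_mul (2 * t)).sub (hasDerivAt_pow 2 s)).mul_const _).add
      ((hasDerivAt_pow 2 s).mul_const _)).congr_deriv ?_
    push_cast; ring
  have h := norm_sub_le_of_norm_deriv_le ht hG hB (by simp) (fun s hs => by
    have hs' : t - s ∈ Set.Icc 0 t := ⟨by linarith [hs.2], by linarith [hs.1]⟩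
    have hXsplit : exp (t • X) = exp (s • X) * exp ((t - s) • X) :=
      exp_smul_eq_mul_exp_sub_smul X t s
    have hYsplit : exp (t • Y) = exp (s • Y) * exp ((t - s) • Y) :=
      exp_smul_eq_mul_exp_sub_smul Y t s
    have key : exp (s • X) * C * exp ((t - s) • X) * (exp (t • Y) * exp (t • X))
        + exp (t • X) * (exp (s • Y) * (Y * X - X * Y) * exp ((t - s) • Y)) * exp (t • X)
        = -(exp (s • X) * ((exp ((t - s) • X) * C - C * exp ((t - s) • X))
            * (exp (t • Y) * exp (t • X))))
          - exp (t • X) * ((exp (s • Y) * C - C * exp (s • Y)) *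
              (exp ((t - s) • Y) * exp (t • X))) := by
      have h1 : exp (s • X) * (exp ((t - s) • X) * C * (exp (t • Y) * exp (t • X)))
          = exp (t • X) * (C * (exp (s • Y) * (exp ((t - s) • Y) * exp (t • X)))) := by
        rw [← mul_assoc (exp (s • Y)), ← hYsplit, hXsplit]
        simp only [mul_assoc]
      have h2 : Y * X - X * Y = -C := by rw [hC, neg_sub]
      rw [h2]
      simp only [sub_mul, mul_sub, h1]
      noncomm_ring
    rw [key]
    refine norm_sub_le_of_le ?_ ?_
    · rw [norm_neg]
      refine norm_mul_le_of_norm_le_one_left (hX s hs) (norm_mul_le_of_norm_le_one_right ?_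
        (norm_mul_le_of_norm_le_one_left (hY t htt) (hX t htt)))
      exact (norm_exp_commutator_le C hs'.1 fun u hu => hX u ⟨hu.1, hu.2.trans hs'.2⟩).trans
        (mul_le_mul_of_nonneg_left (norm_commutator_le X C) hs'.1)
    · refine norm_mul_le_of_norm_le_one_left (hX t htt) (norm_mul_le_of_norm_le_one_right ?_
        (norm_mul_le_of_norm_le_one_left (hY _ hs') (hX t htt)))
      exact (norm_exp_commutator_le C hs.1 fun u hu => hY u ⟨hu.1, hu.2.trans hs.2⟩).trans
        (mul_le_mul_of_nonneg_left (norm_commutator_le Y C) hs.1))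
  refine (le_of_eq ?_).trans (h.trans_eq ?_)
  · simp only [sub_self, zero_smul, exp_zero, one_mul, mul_one, sub_zero]
    congr 1
    noncomm_ring
  · ring

/-- Error bound for the second-order Strang splitting of contraction semigroups. -/
theorem norm_exp_sub_strang_le {X Y : A} {t : ℝ} (ht : 0 ≤ t)
    (hX : ∀ u ∈ Set.Icc 0 t, ‖exp (u • X)‖ ≤ 1) (hY : ∀ u ∈ Set.Icc 0 t, ‖exp (u • Y)‖ ≤ 1)
    (hXY : ∀ u ∈ Set.Icc 0 t, ‖exp (u • (X + Y + X))‖ ≤ 1) :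
    ‖exp (t • (X + Y + X)) - exp (t • X) * exp (t • Y) * exp (t • X)‖
      ≤ t ^ 3 / 3 * (‖X * Y - Y * X‖ * (‖X‖ + ‖Y‖)) := by
  set L := X + Y + X with hL
  have hF : ∀ s, HasDerivAt (fun s : ℝ =>
      exp ((t - s) • L) * (exp (s • X) * exp (s • Y) * exp (s • X)))
      (exp ((t - s) • L) * ((exp (s • X) * Y - Y * exp (s • X)) * exp (s • Y) * exp (s • X)
        + exp (s • X) * (exp (s • Y) * X - X * exp (s • Y)) * exp (s • X))) s := by
    intro s
    have hcomm : L * exp ((t - s) • L) = exp ((t - s) • L) * L :=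
      (((Commute.refl L).smul_right (t - s)).exp_right).eq
    have hcommX : X * exp (s • X) = exp (s • X) * X :=
      (((Commute.refl X).smul_right s).exp_right).eq
    refine ((hasDerivAt_exp_sub_smul_const L t s).mul
      (((hasDerivAt_exp_smul_const' X s).mul (hasDerivAt_exp_smul_const' Y s)).mul
        (hasDerivAt_exp_smul_const' X s))).congr_deriv ?_
    rw [hcomm]
    generalize exp ((t - s) • L) = E
    rw [hL]
    simp only [Pi.mul_apply, mul_add, add_mul, mul_sub, sub_mul, neg_mul, ← mul_assoc]
    rw [mul_assoc E (exp (s • X)) X, ← hcommX]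
    noncomm_ring
  have hB : ∀ s : ℝ, HasDerivAt
      (fun s : ℝ => s ^ 3 / 3 * (‖X * Y - Y * X‖ * (‖X‖ + ‖Y‖)))
      (s ^ 2 * (‖X * Y - Y * X‖ * (‖X‖ + ‖Y‖))) s := by
    intro s
    refine (((hasDerivAt_pow 3 s).div_const 3).mul_const _).congr_deriv ?_
    push_cast; ring
  have h := norm_sub_le_of_norm_deriv_le ht hF hB (by simp) (fun s hs =>
    norm_mul_le_of_norm_le_one_left (hXY _ ⟨by linarith [hs.2], by linarith [hs.1]⟩)
      (norm_strang_defect_le hs.1 (fun u hu => hX u ⟨hu.1, hu.2.trans hs.2⟩)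
        (fun u hu => hY u ⟨hu.1, hu.2.trans hs.2⟩)))
  rw [norm_sub_rev]
  simpa using h

end StrangSplitting

theorem total_simulation_error_bound {A : Type*} [NormedRing A] [NormedAlgebra ℂ A]
    [CompleteSpace A] (H D : A) (δ : ℝ) (hδ : 0 < δ) (r : ℕ) (hr : 0 < r)
    (hH : ∀ u ∈ Set.Icc (0 : ℝ) (r * δ), ‖exp (u • H)‖ ≤ 1)
    (hD : ∀ u ∈ Set.Icc (0 : ℝ) (r * δ), ‖exp (u • D)‖ ≤ 1)
    (hHD : ∀ u ∈ Set.Icc (0 : ℝ) (r * δ), ‖exp (u • (H + D))‖ ≤ 1)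
    (hnorm : (‖H‖ / 2 + ‖D‖) * δ ≤ 1)
    (K N : A) (hK : ‖K‖ ≤ 1) (hN : ‖N‖ ≤ 1) :
    ‖exp (((r : ℝ) * δ) • (H + D)) - (K * N * K) ^ r‖
      ≤ (‖H * D - D * H‖ / 3) * (‖H‖ / 2 + ‖D‖) * r * δ ^ 3 +
        2 * r * (‖exp ((δ / 2) • H) - K‖ + ‖exp (δ • D) - N‖) := by
  have hδr : δ ≤ r * δ := le_mul_of_one_le_left hδ.le (by exact_mod_cast hr)
  have hδ' : δ ∈ Set.Icc (0 : ℝ) (r * δ) := ⟨hδ.le, hδr⟩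
  have h1 : ‖(1 : A)‖ ≤ 1 := by simpa using hH 0 ⟨le_rfl, hδ.le.trans hδr⟩
  have hhalf : ∀ u : ℝ, u • ((1 / 2 : ℝ) • H) = (u / 2) • H := fun u => by
    rw [smul_smul, mul_one_div]
  have hsum : (1 / 2 : ℝ) • H + D + (1 / 2 : ℝ) • H = H + D := by module
  have hP : ‖exp ((δ / 2) • H)‖ ≤ 1 := hH _ ⟨by linarith, by linarith⟩
  have hstrang := norm_exp_sub_strang_le (X := (1 / 2 : ℝ) • H) (Y := D) hδ.le
    (fun u hu => by rw [hhalf]; exact hH _ ⟨by linarith [hu.1], by linarith [hu.1, hu.2]⟩)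
    (fun u hu => hD u ⟨hu.1, hu.2.trans hδr⟩)
    (fun u hu => by rw [hsum]; exact hHD u ⟨hu.1, hu.2.trans hδr⟩)
  have hC : (1 / 2 : ℝ) • H * D - D * (1 / 2 : ℝ) • H = (1 / 2 : ℝ) • (H * D - D * H) := by
    rw [smul_mul_assoc, mul_smul_comm, smul_sub]
  rw [hhalf, hsum, hC, norm_smul, norm_smul, Real.norm_of_nonneg (by norm_num : (0 : ℝ) ≤ 1 / 2)]
    at hstrang
  have hgadget := norm_mul_mul_sub_mul_mul_le hP hK (hD δ hδ') hN
  have hstep := norm_sub_le_norm_sub_add_norm_sub (exp (δ • (H + D)))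
    (exp ((δ / 2) • H) * exp (δ • D) * exp ((δ / 2) • H)) (K * N * K)
  have hpow : exp (((r : ℝ) * δ) • (H + D)) = exp (δ • (H + D)) ^ r := by
    let := NormedAlgebra.restrictScalars ℚ ℂ A
    rw [← exp_nsmul, mul_smul, Nat.cast_smul_eq_nsmul]
  rw [hpow]
  have hKNK : ‖K * N * K‖ ≤ 1 :=
    norm_mul_le_of_norm_le_one_left (norm_mul_le_of_norm_le_one_left hK hN) hK
  refine (norm_pow_sub_pow_le_of_norm_le_one h1 (hHD δ hδ') hKNK r).trans ?_
  have hM : 0 ≤ δ ^ 3 * (‖H * D - D * H‖ * (‖H‖ / 2 + ‖D‖)) := by positivity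
  have hε : 0 ≤ ‖exp (δ • D) - N‖ := norm_nonneg _
  calc (r : ℝ) * ‖exp (δ • (H + D)) - K * N * K‖
      ≤ r * (δ ^ 3 / 3 * (‖H * D - D * H‖ * (‖H‖ / 2 + ‖D‖))
          + 2 * (‖exp ((δ / 2) • H) - K‖ + ‖exp (δ • D) - N‖)) := by
        gcongr
        linarith
    _ = _ := by ring
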